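/- Let G be a countable discrete infinite amenable group, π : (X,G) → (Y,G) a factor map between G-systems, μ a G-invariant Borel probability measure on X, and d ∈ ℕ a fixed positive integer. For each ε > 0 there exists δ > 0 such that for any two finite Borel covers 𝒰 = {U_1,…,U_d} and 𝒱 = {V_1,…,V_d} of X with Σ_{i=1}^d μ(U_i △ V_i) < δ, one has |Asc_μ^+(G,𝒱|Y) − Asc_μ^+(G,𝒰|Y)| < ε. -/

import Mathlib

open MeasureTheory Filter Set

noncomputable section

namespace AscLocal

/-- Limit of a real sequence (a junk value if the sequence does not converge). -/
def limSeq (f : ℕ → ℝ) : ℝ := limUnder Filter.atTop f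

variable {G X Y : Type*}

/-- `U` is a cover of the whole space. -/
def IsCover (U : Finset (Set X)) : Prop := ⋃₀ (U : Set (Set X)) = Set.univ

/-- every member of `α` is contained in some member of `U` (`α ⪰ U`). -/
def Refines (α U : Finset (Set X)) : Prop := ∀ A ∈ α, ∃ B ∈ U, A ⊆ B

/-- `α` is a finite measurable partition of the space. -/
def IsMPartition [MeasurableSpace X] (α : Finset (Set X)) : Prop :=
  IsCover α ∧ (∀ A ∈ α, MeasurableSet A) ∧
    ∀ A ∈ α, ∀ B ∈ α, A ≠ B → Disjoint A B

/-- Følner sequence of a group. -/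
def IsFolner [Group G] [DecidableEq G] (F : ℕ → Finset G) : Prop :=
  (∀ n, (F n).Nonempty) ∧
    ∀ g : G, Tendsto (fun n =>
      ((((((F n).image fun h => g * h) \ F n) ∪ (F n \ ((F n).image fun h => g * h)))).card : ℝ)
        / ((F n).card : ℝ)) atTop (nhds 0)

/-- The join `⋁_{g ∈ S} g⁻¹ U` of the pullbacks of the cover `U` under the action `act`. -/
def coverDyn [DecidableEq G] (act : G → X → X) (U : Finset (Set X)) (S : Finset G) :
    Finset (Set X) := by
  classical
  exact (S.pi fun _ => U).image fun f => ⋂ g, ⋂ (h : g ∈ S), act g ⁻¹' f g h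

/-- The join `⋁_{i ∈ S} T^{-i} U` for a single transformation `T`. -/
def coverIt (T : X → X) (U : Finset (Set X)) (S : Finset ℕ) : Finset (Set X) := by
  classical
  exact (S.pi fun _ => U).image fun f => ⋂ i, ⋂ (h : i ∈ S), (T^[i]) ⁻¹' f i h

/-- join of two finite families of sets. -/
def joinP (α β : Finset (Set X)) : Finset (Set X) := by
  classical
  exact (α ×ˢ β).image fun p => p.1 ∩ p.2

/-- minimal number of members of `U` needed to cover `K`. -/
def covNum (U : Finset (Set X)) (K : Set X) : ℕ :=
  sInf {n | ∃ V : Finset (Set X), V ⊆ U ∧ V.card = n ∧ K ⊆ ⋃₀ (V : Set (Set X))}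

/-- `N(U|Y) = sup_y N(U | pr⁻¹ y)` for a factor map `pr : X → Y`. -/
def covNumRel (pr : X → Y) (U : Finset (Set X)) : ℕ :=
  sSup {n | ∃ y : Y, n = covNum U (pr ⁻¹' {y})}

/-- Shannon entropy of a finite partition. -/
def entPart [MeasurableSpace X] (μ : Measure X) (α : Finset (Set X)) : ℝ :=
  ∑ A ∈ α, Real.negMulLog (μ A).toReal

/-- entropy of a finite cover: infimum over finer partitions. -/
def entCov [MeasurableSpace X] (μ : Measure X) (U : Finset (Set X)) : ℝ :=
  sInf {h | ∃ α, IsMPartition (X := X) α ∧ Refines α U ∧ h = entPart μ α}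

/-- conditional entropy of a partition given the σ-algebra `pr⁻¹ ℬ(Y)`:
`H_μ(α|Y) = ∑_{A ∈ α} ∫ -E(1_A|pr⁻¹ ℬ(Y)) log E(1_A|pr⁻¹ ℬ(Y)) dμ`. -/
def condEntPart [MeasurableSpace X] [MeasurableSpace Y] (μ : Measure X) (pr : X → Y)
    (α : Finset (Set X)) : ℝ :=
  ∑ A ∈ α, ∫ x, Real.negMulLog
    ((μ[A.indicator (fun _ => (1 : ℝ)) | MeasurableSpace.comap pr ‹_›]) x) ∂μ

/-- conditional entropy of a cover given `pr⁻¹ ℬ(Y)`: infimum over finer partitions. -/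
def condEntCover [MeasurableSpace X] [MeasurableSpace Y] (μ : Measure X) (pr : X → Y)
    (U : Finset (Set X)) : ℝ :=
  sInf {h | ∃ α, IsMPartition (X := X) α ∧ Refines α U ∧ h = condEntPart μ pr α}

/-- the coefficient `c^A_S = ∫ x^{|S|} (1-x)^{|A|-|S|} dλ(x)`. -/
def coeff (lam : Measure ℝ) (A S : Finset G) : ℝ :=
  ∫ x, x ^ S.card * (1 - x) ^ (A.card - S.card) ∂lam

/-- `lam` is a symmetric probability measure on `[0,1]`. -/
def IsCoeffMeasure (lam : Measure ℝ) : Prop :=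
  IsProbabilityMeasure lam ∧ lam (Set.Icc (0 : ℝ) 1)ᶜ = 0 ∧
    lam.map (fun x => 1 - x) = lam

/-- the uniform system of coefficients `c^A_S = 2^{-|A|}`. -/
def unifCoeff (A _S : Finset G) : ℝ := (1 / 2) ^ A.card

/-- the finite family `{U 0, …, U (d-1)}` as a `Finset` of sets. -/
def ofFun {d : ℕ} (U : Fin d → Set X) : Finset (Set X) := by
  classical
  exact Finset.univ.image U

section GroupAsc

variable [Group G] [DecidableEq G]

/-- the sequence `n ↦ (1/|F_n|) ∑_{S ⊆ F_n} c^{F_n}_S H_μ(α_S|Y)`. -/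
def ascCondPartSeq [MeasurableSpace X] [MeasurableSpace Y] (μ : Measure X) (pr : X → Y)
    (c : Finset G → Finset G → ℝ) (act : G → X → X) (α : Finset (Set X))
    (F : ℕ → Finset G) (n : ℕ) : ℝ :=
  (1 / ((F n).card : ℝ)) *
    ∑ S ∈ (F n).powerset, c (F n) S * condEntPart μ pr (coverDyn act α S)

/-- `Asc_μ(G,α|Y)`. -/
def AscCondPart [MeasurableSpace X] [MeasurableSpace Y] (μ : Measure X) (pr : X → Y)
    (c : Finset G → Finset G → ℝ) (act : G → X → X) (α : Finset (Set X))
    (F : ℕ → Finset G) : ℝ :=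
  limSeq (ascCondPartSeq μ pr c act α F)

/-- `Asc_μ^-(G,U|Y)`. -/
def AscCondMinus [MeasurableSpace X] [MeasurableSpace Y] (μ : Measure X) (pr : X → Y)
    (c : Finset G → Finset G → ℝ) (act : G → X → X) (U : Finset (Set X))
    (F : ℕ → Finset G) : ℝ :=
  limSeq fun n => (1 / ((F n).card : ℝ)) *
    ∑ S ∈ (F n).powerset, c (F n) S * condEntCover μ pr (coverDyn act U S)

/-- `Asc_μ^+(G,U|Y)`. -/
def AscCondPlus [MeasurableSpace X] [MeasurableSpace Y] (μ : Measure X) (pr : X → Y)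
    (c : Finset G → Finset G → ℝ) (act : G → X → X) (U : Finset (Set X))
    (F : ℕ → Finset G) : ℝ :=
  sInf {h | ∃ α, IsMPartition (X := X) α ∧ Refines α U ∧ h = AscCondPart μ pr c act α F}

/-- `Asc_μ(G,X|Y) = sup_α Asc_μ(G,α|Y)`. -/
def AscCondSup [MeasurableSpace X] [MeasurableSpace Y] (μ : Measure X) (pr : X → Y)
    (c : Finset G → Finset G → ℝ) (act : G → X → X) (F : ℕ → Finset G) : ℝ :=
  sSup {h | ∃ α, IsMPartition (X := X) α ∧ h = AscCondPart μ pr c act α F}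

/-- unconditional `Asc_μ(G,α)`. -/
def AscPart [MeasurableSpace X] (μ : Measure X)
    (c : Finset G → Finset G → ℝ) (act : G → X → X) (α : Finset (Set X))
    (F : ℕ → Finset G) : ℝ :=
  limSeq fun n => (1 / ((F n).card : ℝ)) *
    ∑ S ∈ (F n).powerset, c (F n) S * entPart μ (coverDyn act α S)

/-- unconditional `Asc_μ^-(G,U)`. -/
def AscMinus [MeasurableSpace X] (μ : Measure X)
    (c : Finset G → Finset G → ℝ) (act : G → X → X) (U : Finset (Set X))
    (F : ℕ → Finset G) : ℝ :=
  limSeq fun n => (1 / ((F n).card : ℝ)) *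
    ∑ S ∈ (F n).powerset, c (F n) S * entCov μ (coverDyn act U S)

/-- unconditional `Asc_μ^+(G,U)`. -/
def AscPlus [MeasurableSpace X] (μ : Measure X)
    (c : Finset G → Finset G → ℝ) (act : G → X → X) (U : Finset (Set X))
    (F : ℕ → Finset G) : ℝ :=
  sInf {h | ∃ α, IsMPartition (X := X) α ∧ Refines α U ∧ h = AscPart μ c act α F}

/-- conditional topological average sample complexity `Asc_top(G,U|Y)`. -/
def AscTopRel (c : Finset G → Finset G → ℝ) (act : G → X → X) (pr : X → Y)
    (U : Finset (Set X)) (F : ℕ → Finset G) : ℝ :=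
  limSeq fun n => (1 / ((F n).card : ℝ)) *
    ∑ S ∈ (F n).powerset, c (F n) S * Real.log (covNumRel pr (coverDyn act U S))

/-- topological average sample complexity `Asc_top(G,U)`. -/
def AscTop (c : Finset G → Finset G → ℝ) (act : G → X → X)
    (U : Finset (Set X)) (F : ℕ → Finset G) : ℝ :=
  limSeq fun n => (1 / ((F n).card : ℝ)) *
    ∑ S ∈ (F n).powerset, c (F n) S * Real.log (covNum (coverDyn act U S) Set.univ)

/-- `ν` is `G`-invariant and ergodic for the action `act`. -/
def IsErgodicAct [MeasurableSpace X] (act : G → X → X) (ν : Measure X) : Prop :=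
  (∀ g, Measure.map (act g) ν = ν) ∧
    ∀ A : Set X, MeasurableSet A → (∀ g, act g ⁻¹' A = A) → ν A = 0 ∨ ν A = 1

end GroupAsc

/-- `Asc_μ(T,α|Y)` for a `ℤ`-system, uniform coefficients `2^{-n}`. -/
def zAscCondPart [MeasurableSpace X] [MeasurableSpace Y] (μ : Measure X) (pr : X → Y)
    (T : X → X) (α : Finset (Set X)) : ℝ :=
  limSeq fun n => (1 / (n : ℝ)) * ∑ S ∈ (Finset.range n).powerset,
    ((1 : ℝ) / 2) ^ n * condEntPart μ pr (coverIt T α S)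

/-- `Asc_μ^-(T,U|Y)` for a `ℤ`-system, uniform coefficients. -/
def zAscCondMinus [MeasurableSpace X] [MeasurableSpace Y] (μ : Measure X) (pr : X → Y)
    (T : X → X) (U : Finset (Set X)) : ℝ :=
  limSeq fun n => (1 / (n : ℝ)) * ∑ S ∈ (Finset.range n).powerset,
    ((1 : ℝ) / 2) ^ n * condEntCover μ pr (coverIt T U S)

/-- `Asc_μ^+(T,U|Y)` for a `ℤ`-system, uniform coefficients. -/
def zAscCondPlus [MeasurableSpace X] [MeasurableSpace Y] (μ : Measure X) (pr : X → Y)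
    (T : X → X) (U : Finset (Set X)) : ℝ :=
  sInf {h | ∃ α, IsMPartition (X := X) α ∧ Refines α U ∧ h = zAscCondPart μ pr T α}

/-- `Asc_top(T,U|Y)` for a `ℤ`-system, uniform coefficients. -/
def zAscTop (T : X → X) (pr : X → Y) (U : Finset (Set X)) : ℝ :=
  limSeq fun n => (1 / (n : ℝ)) * ∑ S ∈ (Finset.range n).powerset,
    ((1 : ℝ) / 2) ^ n * Real.log (covNumRel pr (coverIt T U S))

end AscLocal

open AscLocal
namespace Asc6

section Comb
variable {G : Type*} [DecidableEq G]

theorem shearer {ι : Type*} (f : Finset G → ℝ) (f0 : f ∅ = 0)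
    (fmono : ∀ a A, f A ≤ f (insert a A))
    (fsub : ∀ a A B, A ⊆ B → a ∉ B → f (insert a B) + f A ≤ f (insert a A) + f B)
    (I : Finset ι) (A : ι → Finset G) (k : ℕ) (F : Finset G)
    (hk : ∀ a ∈ F, k ≤ (I.filter fun i => a ∈ A i).card) :
    (k : ℝ) * f F ≤ ∑ i ∈ I, f (A i ∩ F) := by
  induction F using Finset.induction_on with
  | empty => simp [f0]
  | insert a F ha ih =>
    have ih' := ih fun b hb => hk b (Finset.mem_insert_of_mem hb)
    have h1 : ∀ i ∈ I, f (A i ∩ F) + (if a ∈ A i then f (insert a F) - f F else 0)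
        ≤ f (A i ∩ insert a F) := by
      intro i _
      split_ifs with h
      · rw [Finset.inter_insert_of_mem h]
        have := fsub a (A i ∩ F) F Finset.inter_subset_right ha
        linarith
      · rw [Finset.inter_insert_of_notMem h]; simp
    have h2 := Finset.sum_le_sum h1
    rw [Finset.sum_add_distrib, ← Finset.sum_filter, Finset.sum_const, nsmul_eq_mul] at h2
    have h3 : (k : ℝ) ≤ ((I.filter fun i => a ∈ A i).card : ℝ) := by
      exact_mod_cast hk a (Finset.mem_insert_self _ _)
    have h4 := fmono a F
    have h5 := mul_le_mul_of_nonneg_right h3 (sub_nonneg.2 h4)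
    nlinarith

/-- average -/
def av (c : Finset G → Finset G → ℝ) (H : Finset G → ℝ) (A : Finset G) : ℝ :=
  ∑ S ∈ A.powerset, c A S * H S

def inc (c : Finset G → Finset G → ℝ) (H : Finset G → ℝ) (a : G) (A : Finset G) : ℝ :=
  ∑ S ∈ A.powerset, c (insert a A) (insert a S) * (H (insert a S) - H S)

variable {c : Finset G → Finset G → ℝ} {H : Finset G → ℝ}

theorem av_insert
    (hcons : ∀ a A S, a ∉ A → S ⊆ A → c A S = c (insert a A) S + c (insert a A) (insert a S))
    {a : G} {A : Finset G} (ha : a ∉ A) : av c H (insert a A) = av c H A + inc c H a A := by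
  unfold av inc
  rw [Finset.sum_powerset_insert ha, ← Finset.sum_add_distrib, ← Finset.sum_add_distrib]
  refine Finset.sum_congr rfl fun S hS => ?_
  rw [hcons a A S ha (Finset.mem_powerset.1 hS)]
  ring

theorem inc_step (hc0 : ∀ A S, 0 ≤ c A S)
    (hcons : ∀ a A S, a ∉ A → S ⊆ A → c A S = c (insert a A) S + c (insert a A) (insert a S))
    (hsub : ∀ a S T, S ⊆ T → H (insert a T) + H S ≤ H (insert a S) + H T)
    {a b : G} {A : Finset G} (hb : b ∉ A) (hab : a ≠ b) :
    inc c H a (insert b A) ≤ inc c H a A := by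
  unfold inc
  rw [Finset.sum_powerset_insert hb, ← Finset.sum_add_distrib]
  refine Finset.sum_le_sum fun S hS => ?_
  have hS' := Finset.mem_powerset.1 hS
  have hb' : b ∉ insert a A := by
    simp only [Finset.mem_insert, not_or]; exact ⟨hab.symm, hb⟩
  rw [hcons b (insert a A) (insert a S) hb' (Finset.insert_subset_insert a hS'),
    Finset.insert_comm b a A, Finset.insert_comm b a S]
  have h1 := hsub a S (insert b S) (Finset.subset_insert _ _)
  have h2 := hc0 (insert a (insert b A)) (insert a (insert b S))
  nlinarith

theorem inc_anti (hc0 : ∀ A S, 0 ≤ c A S)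
    (hcons : ∀ a A S, a ∉ A → S ⊆ A → c A S = c (insert a A) S + c (insert a A) (insert a S))
    (hsub : ∀ a S T, S ⊆ T → H (insert a T) + H S ≤ H (insert a S) + H T)
    {a : G} {A B : Finset G} (hAB : A ⊆ B) (ha : a ∉ B) :
    inc c H a B ≤ inc c H a A := by
  have key : ∀ C : Finset G, a ∉ A ∪ C → inc c H a (A ∪ C) ≤ inc c H a A := by
    intro C
    induction C using Finset.induction_on with
    | empty => simp
    | insert b C _ ih =>
      intro h
      rw [Finset.union_insert] at h ⊢
      simp only [Finset.mem_insert, not_or] at h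
      by_cases hb : b ∈ A ∪ C
      · rw [Finset.insert_eq_of_mem hb]; exact ih h.2
      · exact (inc_step hc0 hcons hsub hb h.1).trans (ih h.2)
  have := key B
  rw [Finset.union_eq_right.2 hAB] at this
  exact this ha

theorem inc_nonneg (hc0 : ∀ A S, 0 ≤ c A S) (hmono : ∀ a S, H S ≤ H (insert a S))
    (a : G) (A : Finset G) : 0 ≤ inc c H a A :=
  Finset.sum_nonneg fun S _ => mul_nonneg (hc0 _ _) (sub_nonneg.2 (hmono a S))

theorem av_mono1 (hc0 : ∀ A S, 0 ≤ c A S)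
    (hcons : ∀ a A S, a ∉ A → S ⊆ A → c A S = c (insert a A) S + c (insert a A) (insert a S))
    (hmono : ∀ a S, H S ≤ H (insert a S)) (a : G) (A : Finset G) :
    av c H A ≤ av c H (insert a A) := by
  by_cases ha : a ∈ A
  · rw [Finset.insert_eq_of_mem ha]
  · rw [av_insert hcons ha]
    linarith [inc_nonneg (c := c) hc0 hmono a A]

theorem mono_of_insert {f : Finset G → ℝ} (fmono : ∀ a A, f A ≤ f (insert a A))
    {A B : Finset G} (h : A ⊆ B) : f A ≤ f B := by
  have key : ∀ C : Finset G, f A ≤ f (A ∪ C) := by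
    intro C
    induction C using Finset.induction_on with
    | empty => simp
    | insert b C _ ih => rw [Finset.union_insert]; exact ih.trans (fmono _ _)
  have := key B
  rwa [Finset.union_eq_right.2 h] at this

theorem folner_limit [Group G] (F : ℕ → Finset G) (hF : IsFolner F)
    (f : Finset G → ℝ) (f0 : f ∅ = 0)
    (fmono : ∀ a A, f A ≤ f (insert a A))
    (fsub : ∀ a A B, A ⊆ B → a ∉ B → f (insert a B) + f A ≤ f (insert a A) + f B)
    (finv : ∀ (g : G) (A : Finset G), f (A.image fun h => h * g) = f A) :
    ∃ L, Tendsto (fun n => (1 / ((F n).card : ℝ)) * f (F n)) atTop (nhds L) := by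
  have fnn : ∀ A, 0 ≤ f A := fun A => f0 ▸ mono_of_insert fmono (Finset.empty_subset A)
  let W : Set ℝ := {r | ∃ K : Finset G, K.Nonempty ∧ r = (1 / (K.card : ℝ)) * f K}
  have hWb : BddBelow W := by
    refine ⟨0, ?_⟩
    rintro r ⟨K, _, rfl⟩
    exact mul_nonneg (by positivity) (fnn K)
  have hWn : W.Nonempty := ⟨_, F 0, hF.1 0, rfl⟩
  refine ⟨sInf W, ?_⟩
  rw [tendsto_order]
  refine ⟨fun b hb => Eventually.of_forall fun n =>
    hb.trans_le (csInf_le hWb ⟨F n, hF.1 n, rfl⟩), fun b hb => ?_⟩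
  obtain ⟨r, ⟨K, hK, rfl⟩, hr⟩ := exists_lt_of_csInf_lt hWn hb
  let e : ℕ → ℝ := fun n => ∑ k ∈ K, ((((((F n).image fun h => k⁻¹ * h) \ F n) ∪
    (F n \ ((F n).image fun h => k⁻¹ * h)))).card : ℝ) / ((F n).card : ℝ)
  have he : Tendsto e atTop (nhds 0) := by
    have := tendsto_finsetSum K (fun k _ => hF.2 k⁻¹)
    rw [Finset.sum_const_zero] at this
    exact this
  have hmain : ∀ n, (1 / ((F n).card : ℝ)) * f (F n) ≤ (1 + e n) * ((1 / (K.card : ℝ)) * f K) := by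
    intro n
    have hFp : (0 : ℝ) < (F n).card := by exact_mod_cast (hF.1 n).card_pos
    have hKp : (0 : ℝ) < K.card := by exact_mod_cast hK.card_pos
    let I : Finset G := K.biUnion fun k => (F n).image fun h => k⁻¹ * h
    have h1 : (K.card : ℝ) * f (F n) ≤ ∑ g ∈ I, f ((K.image fun h => h * g) ∩ F n) := by
      refine shearer f f0 fmono fsub I (fun g => K.image fun h => h * g) K.card (F n) ?_
      intro a ha
      refine Finset.card_le_card_of_injOn (fun k => k⁻¹ * a) ?_ ?_
      · intro k hk
        rw [Finset.mem_coe, Finset.mem_filter]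
        refine ⟨Finset.mem_biUnion.2 ⟨k, hk, Finset.mem_image_of_mem _ ha⟩,
          Finset.mem_image.2 ⟨k, hk, by group⟩⟩
      · intro k _ l _ hkl
        simpa using hkl
    have h2 : ∑ g ∈ I, f ((K.image fun h => h * g) ∩ F n) ≤ (I.card : ℝ) * f K := by
      rw [← nsmul_eq_mul]
      refine Finset.sum_le_card_nsmul _ _ _ fun g _ => ?_
      rw [← finv g K]
      exact mono_of_insert fmono Finset.inter_subset_left
    have h3 : (I.card : ℝ) ≤ (F n).card + ∑ k ∈ K, ((((((F n).image fun h => k⁻¹ * h) \ F n) ∪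
        (F n \ ((F n).image fun h => k⁻¹ * h)))).card : ℝ) := by
      have hI : I ⊆ F n ∪ K.biUnion fun k => ((((F n).image fun h => k⁻¹ * h) \ F n) ∪
        (F n \ ((F n).image fun h => k⁻¹ * h))) := by
        intro x hx
        obtain ⟨k, hk, hx⟩ := Finset.mem_biUnion.1 hx
        by_cases hxF : x ∈ F n
        · exact Finset.mem_union_left _ hxF
        · exact Finset.mem_union_right _ (Finset.mem_biUnion.2 ⟨k, hk,
            Finset.mem_union_left _ (Finset.mem_sdiff.2 ⟨hx, hxF⟩)⟩)
      have h4 := (Finset.card_le_card hI).trans ((Finset.card_union_le _ _).trans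
        (Nat.add_le_add_left Finset.card_biUnion_le _))
      exact_mod_cast h4
    have h4 : (1 + e n) * (F n).card = (F n).card + ∑ k ∈ K, ((((((F n).image fun h => k⁻¹ * h) \ F n) ∪
        (F n \ ((F n).image fun h => k⁻¹ * h)))).card : ℝ) := by
      simp only [e, ← Finset.sum_div]
      field_simp
    have h5 : (K.card : ℝ) * f (F n) ≤ (1 + e n) * (F n).card * f K := by
      rw [h4]
      exact (h1.trans h2).trans (mul_le_mul_of_nonneg_right h3 (fnn K))
    have h6 : (1 / ((F n).card : ℝ)) * f (F n) = (K.card : ℝ) * f (F n) / (K.card * (F n).card) := by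
      field_simp
    rw [h6, div_le_iff₀ (by positivity)]
    refine h5.trans (le_of_eq ?_)
    field_simp
  have hlim : Tendsto (fun n => (1 + e n) * ((1 / (K.card : ℝ)) * f K)) atTop
      (nhds ((1 + 0) * ((1 / (K.card : ℝ)) * f K))) :=
    (tendsto_const_nhds.add he).mul_const _
  rw [add_zero, one_mul] at hlim
  filter_upwards [hlim.eventually (gt_mem_nhds hr)] with n hn
  exact (hmain n).trans_lt hn

end Comb
end Asc6
namespace Asc6
section Ent
open ProbabilityTheory

def ent {X ι : Type*} [MeasurableSpace X] [Fintype ι] (ν : Measure X) (f : X → ι) : ℝ :=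
  ∑ i, Real.negMulLog (ν.real (f ⁻¹' {i}))

/-- all level sets measurable -/
def LM {X ι : Type*} [MeasurableSpace X] (f : X → ι) : Prop := ∀ i, MeasurableSet (f ⁻¹' {i})

section
variable {X : Type*} [MeasurableSpace X] {ι κ ξ : Type*} [Fintype ι] [Fintype κ] [Fintype ξ]

theorem LM.prod {f : X → ι} {g : X → κ} (hf : LM f) (hg : LM g) : LM (fun x => (f x, g x)) := by
  rintro ⟨i, j⟩
  have : (fun x => (f x, g x)) ⁻¹' {(i, j)} = f ⁻¹' {i} ∩ g ⁻¹' {j} := by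
    ext x; simp
  rw [this]; exact (hf i).inter (hg j)

theorem LM.preimage {f : X → ι} (hf : LM f) (s : Set ι) : MeasurableSet (f ⁻¹' s) := by
  have : f ⁻¹' s = ⋃ i ∈ s, f ⁻¹' {i} := by ext x; simp
  rw [this]
  exact MeasurableSet.biUnion (Set.to_countable s) fun i _ => hf i

theorem LM.comp {f : X → ι} (hf : LM f) (φ : ι → κ) : LM (fun x => φ (f x)) := by
  intro j
  exact hf.preimage (φ ⁻¹' {j})

theorem sum_real (ν : Measure X) [IsFiniteMeasure ν] {f : X → ι} (hf : LM f) {s : Set X}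
    (hs : MeasurableSet s) : ∑ i, ν.real (s ∩ f ⁻¹' {i}) = ν.real s := by
  rw [← measureReal_biUnion_finset]
  · congr 1; ext x; simp
  · intro i _ j _ hij
    refine Set.disjoint_left.2 ?_
    rintro x ⟨_, h1⟩ ⟨_, h2⟩
    exact hij (h1.symm.trans h2)
  · intro i _; exact hs.inter (hf i)

theorem ent_le_prod (ν : Measure X) [IsFiniteMeasure ν] {f : X → ι} {g : X → κ}
    (hf : LM f) (hg : LM g) : ent ν f ≤ ent ν (fun x => (f x, g x)) := by
  unfold ent
  rw [Fintype.sum_prod_type]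
  refine Finset.sum_le_sum fun i _ => ?_
  have h0 : ∀ j, (fun x => (f x, g x)) ⁻¹' {(i, j)} = f ⁻¹' {i} ∩ g ⁻¹' {j} := by
    intro j; ext x; simp
  simp only [h0]
  have h1 := sum_real ν hg (hf i)
  conv_lhs => rw [Real.negMulLog, ← h1, neg_mul, Finset.sum_mul, ← Finset.sum_neg_distrib]
  refine Finset.sum_le_sum fun j _ => ?_
  rw [h1, Real.negMulLog, neg_mul, neg_le_neg_iff]
  rcases (measureReal_nonneg (μ := ν) (s := f ⁻¹' {i} ∩ g ⁻¹' {j})).eq_or_lt with h | h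
  · rw [← h]; simp
  · refine mul_le_mul_of_nonneg_left (Real.log_le_log h ?_) h.le
    exact measureReal_mono Set.inter_subset_left

theorem ent_mono (ν : Measure X) [IsFiniteMeasure ν] {f : X → ι} {g : X → κ}
    (hf : LM f) (hg : LM g) (h : ∀ x y, g x = g y → f x = f y) : ent ν f ≤ ent ν g := by
  refine (ent_le_prod ν hf hg).trans (le_of_eq ?_)
  unfold ent
  rw [Fintype.sum_prod_type_right]
  refine Finset.sum_congr rfl fun j _ => ?_
  by_cases hj : ∃ x, g x = j
  · obtain ⟨x, rfl⟩ := hj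
    rw [Finset.sum_eq_single (f x)]
    · congr 2
      ext y
      simp only [Set.mem_preimage, Set.mem_singleton_iff, Prod.mk.injEq]
      exact ⟨fun h => h.2, fun hy => ⟨h _ _ hy, hy⟩⟩
    · intro i _ hi
      have : (fun x => (f x, g x)) ⁻¹' {(i, g x)} = ∅ := by
        ext y
        simp only [Set.mem_preimage, Set.mem_singleton_iff, Prod.mk.injEq, Set.mem_empty_iff_false,
          iff_false, not_and]
        rintro rfl hy
        exact hi (h _ _ hy)
      rw [this]; simp
    · simp
  · push Not at hj
    have h1 : g ⁻¹' {j} = ∅ := by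
      ext y; simpa using hj y
    have h2 : ∀ i, (fun x => (f x, g x)) ⁻¹' {(i, j)} = ∅ := by
      intro i; ext y; simp [hj y]
    simp [h1, h2]

theorem ent_ssa (ν : Measure X) [IsFiniteMeasure ν] {f : X → ι} {g : X → κ} {h : X → ξ}
    (hf : LM f) (hg : LM g) (hh : LM h) :
    ent ν (fun x => (f x, g x, h x)) + ent ν f ≤
      ent ν (fun x => (f x, g x)) + ent ν (fun x => (f x, h x)) := by
  unfold ent
  simp only [Fintype.sum_prod_type]
  rw [← Finset.sum_add_distrib, ← Finset.sum_add_distrib]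
  refine Finset.sum_le_sum fun a _ => ?_
  have e1 : ∀ b, (fun x => (f x, g x)) ⁻¹' {(a, b)} = f ⁻¹' {a} ∩ g ⁻¹' {b} := by
    intro j; ext x; simp
  have e2 : ∀ b, (fun x => (f x, h x)) ⁻¹' {(a, b)} = f ⁻¹' {a} ∩ h ⁻¹' {b} := by
    intro j; ext x; simp
  have e3 : ∀ b c, (fun x => (f x, g x, h x)) ⁻¹' {(a, b, c)}
      = f ⁻¹' {a} ∩ g ⁻¹' {b} ∩ h ⁻¹' {c} := by
    intro b c; ext x; simp [and_assoc]
  simp only [e1, e2, e3]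
  set P : ℝ := ν.real (f ⁻¹' {a}) with hP
  set Q : κ → ℝ := fun b => ν.real (f ⁻¹' {a} ∩ g ⁻¹' {b}) with hQ
  set R : ξ → ℝ := fun c => ν.real (f ⁻¹' {a} ∩ h ⁻¹' {c}) with hR
  set T : κ → ξ → ℝ := fun b c => ν.real (f ⁻¹' {a} ∩ g ⁻¹' {b} ∩ h ⁻¹' {c}) with hT
  have sQ : ∑ b, Q b = P := sum_real ν hg (hf a)
  have sR : ∑ c, R c = P := sum_real ν hh (hf a)
  have sT1 : ∀ b, ∑ c, T b c = Q b := fun b => sum_real ν hh ((hf a).inter (hg b))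
  have sT2 : ∀ c, ∑ b, T b c = R c := by
    intro c
    have := sum_real ν hg ((hf a).inter (hh c))
    simp only [hR, hT]
    rw [← this]
    refine Finset.sum_congr rfl fun b _ => ?_
    rw [Set.inter_right_comm]
  have T0 : ∀ b c, 0 ≤ T b c := fun b c => measureReal_nonneg
  have Q0 : ∀ b, 0 ≤ Q b := fun b => measureReal_nonneg
  have R0 : ∀ c, 0 ≤ R c := fun c => measureReal_nonneg
  have P0 : 0 ≤ P := measureReal_nonneg
  have TQ : ∀ b c, T b c ≤ Q b := fun b c => measureReal_mono Set.inter_subset_left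
  have QP : ∀ b, Q b ≤ P := fun b => measureReal_mono Set.inter_subset_left
  have TR : ∀ b c, T b c ≤ R c := fun b c =>
    measureReal_mono (Set.inter_subset_inter_left _ Set.inter_subset_left)
  have key : ∀ b c, T b c * (Real.log (Q b) + Real.log (R c) - Real.log (T b c) - Real.log P)
      ≤ Q b * R c / P - T b c := by
    intro b c
    rcases (T0 b c).eq_or_lt with h0 | h0
    · rw [← h0]; simp only [zero_mul, sub_zero]
      exact div_nonneg (mul_nonneg (Q0 b) (R0 c)) P0
    · have q := h0.trans_le (TQ b c)
      have r := h0.trans_le (TR b c)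
      have p := q.trans_le (QP b)
      have hl : Real.log (Q b) + Real.log (R c) - Real.log (T b c) - Real.log P
          = Real.log (Q b * R c / T b c / P) := by
        rw [Real.log_div (by positivity) p.ne', Real.log_div (by positivity) h0.ne',
          Real.log_mul q.ne' r.ne']
      rw [hl]
      have := Real.log_le_sub_one_of_pos (x := Q b * R c / T b c / P) (by positivity)
      refine (mul_le_mul_of_nonneg_left this h0.le).trans (le_of_eq ?_)
      field_simp
  have hs := Finset.sum_le_sum fun b (_ : b ∈ Finset.univ) =>
    Finset.sum_le_sum fun c (_ : c ∈ Finset.univ) => key b c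
  have hr : ∑ b, ∑ c, (Q b * R c / P - T b c) = 0 := by
    simp only [Finset.sum_sub_distrib, sT1, sQ]
    simp only [← Finset.sum_div, ← Finset.mul_sum, sR, ← Finset.sum_mul, sQ]
    rcases P0.eq_or_lt with h0 | h0
    · rw [← h0]; simp
    · field_simp; simp
  have hl : ∑ b, ∑ c, T b c * (Real.log (Q b) + Real.log (R c) - Real.log (T b c) - Real.log P)
      = ∑ b, Q b * Real.log (Q b) + ∑ c, R c * Real.log (R c)
        - ∑ b, ∑ c, T b c * Real.log (T b c) - P * Real.log P := by
    have a1 : ∑ b, ∑ c, T b c * Real.log (Q b) = ∑ b, Q b * Real.log (Q b) :=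
      Finset.sum_congr rfl fun b _ => by rw [← Finset.sum_mul, sT1]
    have a2 : ∑ b, ∑ c, T b c * Real.log (R c) = ∑ c, R c * Real.log (R c) := by
      rw [Finset.sum_comm]
      exact Finset.sum_congr rfl fun c _ => by rw [← Finset.sum_mul, sT2]
    have a3 : ∑ b, ∑ c, T b c * Real.log P = P * Real.log P := by
      rw [← sQ, Finset.sum_mul]
      exact Finset.sum_congr rfl fun b _ => by rw [← Finset.sum_mul, sT1]
    rw [← a1, ← a2, ← a3]
    simp only [← Finset.sum_add_distrib, ← Finset.sum_sub_distrib]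
    refine Finset.sum_congr rfl fun b _ => Finset.sum_congr rfl fun c _ => ?_
    ring
  rw [hl, hr] at hs
  simp only [Real.negMulLog, neg_mul, Finset.sum_neg_distrib]
  linarith

theorem ent_const (ν : Measure X) [IsProbabilityMeasure ν] :
    ent ν (fun _ : X => ()) = 0 := by
  simp [ent]

theorem ent_nonneg (ν : Measure X) [IsProbabilityMeasure ν] (f : X → ι) : 0 ≤ ent ν f :=
  Finset.sum_nonneg fun _ _ => Real.negMulLog_nonneg measureReal_nonneg measureReal_le_one

end

section Cond
/-- conditional entropy of a finite valued map -/
def Hf {X ι : Type*} [Fintype ι] (m : MeasurableSpace X) [mX : MeasurableSpace X]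
    (μ : Measure X) (f : X → ι) : ℝ :=
  ∑ i, ∫ x, Real.negMulLog ((μ[(f ⁻¹' {i}).indicator (fun _ => (1 : ℝ)) | m]) x) ∂μ

variable {X : Type*} {m : MeasurableSpace X} [mX : MeasurableSpace X] {ι κ ξ : Type*}
  [Fintype ι] [Fintype κ] [Fintype ξ]
  [StandardBorelSpace X] {μ : Measure X} [IsProbabilityMeasure μ]

theorem int_term (hm : m ≤ mX) {s : Set X} (hs : MeasurableSet s) :
    Integrable (fun x => Real.negMulLog ((condExpKernel μ m x).real s)) μ := by
  have hmeas : Measurable fun x => (condExpKernel μ m x).real s :=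
    ((measurable_condExpKernel hs).mono hm le_rfl).ennreal_toReal
  obtain ⟨C, hC⟩ := isCompact_Icc.exists_bound_of_continuousOn (s := Set.Icc (0 : ℝ) 1)
    Real.continuous_negMulLog.continuousOn
  refine Integrable.of_bound
    (Real.continuous_negMulLog.measurable.comp hmeas).aestronglyMeasurable C ?_
  exact Eventually.of_forall fun x => hC _ ⟨measureReal_nonneg, measureReal_le_one⟩

theorem int_ent (hm : m ≤ mX) {f : X → ι} (hf : LM f) :
    Integrable (fun x => ent (condExpKernel μ m x) f) μ :=
  integrable_finsetSum _ fun i _ => int_term hm (hf i)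

theorem term_eq (hm : m ≤ mX) {s : Set X} (hs : MeasurableSet s) :
    ∫ x, Real.negMulLog ((μ[s.indicator (fun _ => (1 : ℝ)) | m]) x) ∂μ =
      ∫ x, Real.negMulLog ((condExpKernel μ m x).real s) ∂μ := by
  refine integral_congr_ae ?_
  filter_upwards [condExpKernel_ae_eq_condExp (μ := μ) hm hs] with x hx
  rw [hx]

theorem Hf_eq (hm : m ≤ mX) {f : X → ι} (hf : LM f) :
    Hf m μ f = ∫ x, ent (condExpKernel μ m x) f ∂μ := by
  unfold Hf ent
  rw [integral_finsetSum _ fun i _ => int_term hm (hf i)]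
  exact Finset.sum_congr rfl fun i _ => term_eq hm (hf i)

theorem Hf_mono (hm : m ≤ mX) {f : X → ι} {g : X → κ}
    (hf : LM f) (hg : LM g) (h : ∀ x y, g x = g y → f x = f y) : Hf m μ f ≤ Hf m μ g := by
  rw [Hf_eq hm hf, Hf_eq hm hg]
  exact integral_mono (int_ent hm hf) (int_ent hm hg) fun x => ent_mono _ hf hg h

theorem Hf_congr (hm : m ≤ mX) {f : X → ι} {g : X → κ}
    (hf : LM f) (hg : LM g) (h : ∀ x y, g x = g y ↔ f x = f y) : Hf m μ f = Hf m μ g :=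
  le_antisymm (Hf_mono hm hf hg fun x y => (h x y).1) (Hf_mono hm hg hf fun x y => (h x y).2)

theorem Hf_ssa (hm : m ≤ mX) {f : X → ι} {g : X → κ} {h : X → ξ}
    (hf : LM f) (hg : LM g) (hh : LM h) :
    Hf m μ (fun x => (f x, g x, h x)) + Hf m μ f ≤
      Hf m μ (fun x => (f x, g x)) + Hf m μ (fun x => (f x, h x)) := by
  rw [Hf_eq hm hf, Hf_eq hm (hf.prod hg), Hf_eq hm (hf.prod hh), Hf_eq hm (hf.prod (hg.prod hh)),
    ← integral_add (int_ent hm (hf.prod (hg.prod hh))) (int_ent hm hf),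
    ← integral_add (int_ent hm (hf.prod hg)) (int_ent hm (hf.prod hh))]
  exact integral_mono ((int_ent hm (hf.prod (hg.prod hh))).add (int_ent hm hf))
    ((int_ent hm (hf.prod hg)).add (int_ent hm (hf.prod hh))) fun x => ent_ssa _ hf hg hh

theorem LM_unit : LM (fun _ : X => ()) := by
  intro i; simp

theorem Hf_unit (hm : m ≤ mX) : Hf m μ (fun _ : X => ()) = 0 := by
  rw [Hf_eq hm LM_unit]
  simp [ent_const]

theorem Hf_nonneg (hm : m ≤ mX) {f : X → ι} (hf : LM f) : 0 ≤ Hf m μ f := by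
  rw [Hf_eq hm hf]
  exact integral_nonneg fun x => ent_nonneg _ f

theorem Hf_pair (hm : m ≤ mX) {g : X → κ} {h : X → ξ} (hg : LM g) (hh : LM h) :
    Hf m μ (fun x => (g x, h x)) ≤ Hf m μ g + Hf m μ h := by
  have h1 := Hf_ssa (μ := μ) hm (LM_unit (X := X)) hg hh
  rw [Hf_unit hm] at h1
  have h2 : Hf m μ (fun x => (g x, h x)) ≤ Hf m μ (fun x => ((), g x, h x)) :=
    Hf_mono hm (hg.prod hh) (LM_unit.prod (hg.prod hh)) (by simp)
  have h3 : Hf m μ (fun x => ((), g x)) ≤ Hf m μ g :=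
    Hf_mono hm (LM_unit.prod hg) hg (by simp)
  have h4 : Hf m μ (fun x => ((), h x)) ≤ Hf m μ h :=
    Hf_mono hm (LM_unit.prod hh) hh (by simp)
  linarith

theorem Hf_jensen (hm : m ≤ mX) {f : X → ι} (hf : LM f) :
    Hf m μ f ≤ ∑ i, Real.negMulLog (μ.real (f ⁻¹' {i})) := by
  unfold Hf
  refine Finset.sum_le_sum fun i _ => ?_
  rw [term_eq hm (hf i)]
  refine (Real.concaveOn_negMulLog.le_map_integral Real.continuous_negMulLog.continuousOn
    isClosed_Ici (Eventually.of_forall fun x => measureReal_nonneg)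
    (integrable_toReal_condExpKernel (hf i)) (int_term hm (hf i))).trans (le_of_eq ?_)
  congr 1
  rw [integral_congr_ae (condExpKernel_ae_eq_condExp (μ := μ) hm (hf i)), integral_condExp hm,
    integral_indicator (hf i)]
  simp

end Cond

section Inv
variable {X Y : Type*} [mX : MeasurableSpace X] [mY : MeasurableSpace Y]
  {ι : Type*} [Fintype ι] {μ : Measure X} [IsProbabilityMeasure μ]

theorem setInt_inv {T : X → X} (hT : Measurable T) (hmap : Measure.map T μ = μ) {ψ : X → ℝ}
    (hψ : AEStronglyMeasurable ψ μ) {t : Set X} (ht : MeasurableSet t) :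
    ∫ x in T ⁻¹' t, ψ (T x) ∂μ = ∫ x in t, ψ x ∂μ := by
  conv_rhs => rw [← hmap]
  rw [setIntegral_map ht (by rw [hmap]; exact hψ) hT.aemeasurable]

theorem condExp_inv {p : X → Y} (hp : Measurable p) {T : X → X} {R R' : Y → Y}
    (hT : Measurable T) (hR : Measurable R) (hR' : Measurable R')
    (hRR : ∀ y, R' (R y) = y)
    (hmap : Measure.map T μ = μ) (hfac : ∀ x, p (T x) = R (p x))
    {s : Set X} (hs : MeasurableSet s) :
    (fun x => (μ[s.indicator (fun _ => (1 : ℝ)) | MeasurableSpace.comap p mY]) (T x)) =ᵐ[μ]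
      μ[(T ⁻¹' s).indicator (fun _ => (1 : ℝ)) | MeasurableSpace.comap p mY] := by
  have hm : MeasurableSpace.comap p mY ≤ mX := hp.comap_le
  have hTp : MeasurePreserving T μ μ := ⟨hT, hmap⟩
  have hint : ∀ s : Set X, MeasurableSet s → Integrable (s.indicator (fun _ => (1 : ℝ))) μ :=
    fun s hs => (integrable_const 1).indicator hs
  refine ae_eq_condExp_of_forall_setIntegral_eq hm (hint _ (hT hs)) ?_ ?_ ?_
  · intro t _ _
    exact (hTp.integrable_comp_of_integrable integrable_condExp).integrableOn
  · rintro t ⟨B, hB, rfl⟩ _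
    have ht : p ⁻¹' B = T ⁻¹' (p ⁻¹' (R' ⁻¹' B)) := by
      ext x; simp [hfac, hRR]
    have hB' : MeasurableSet (p ⁻¹' (R' ⁻¹' B)) := hp (hR' hB)
    have hsm : AEStronglyMeasurable
        (μ[s.indicator (fun _ => (1 : ℝ)) | MeasurableSpace.comap p mY]) μ :=
      integrable_condExp.aestronglyMeasurable
    have e1 : ∫ x in p ⁻¹' B,
        (μ[s.indicator (fun _ => (1 : ℝ)) | MeasurableSpace.comap p mY]) (T x) ∂μ
        = ∫ x in p ⁻¹' (R' ⁻¹' B), (μ[s.indicator (fun _ => (1 : ℝ)) | MeasurableSpace.comap p mY]) x ∂μ := by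
      rw [ht]
      exact setInt_inv hT hmap hsm hB'
    rw [e1, setIntegral_condExp hm (hint s hs) ⟨_, hR' hB, rfl⟩]
    rw [← setInt_inv hT hmap (hint s hs).aestronglyMeasurable hB', ← ht]
    rfl
  · have h1 : Measurable[MeasurableSpace.comap p mY, MeasurableSpace.comap p mY] T := by
      rintro _ ⟨B, hB, rfl⟩
      refine ⟨R ⁻¹' B, hR hB, ?_⟩
      ext x; simp [hfac]
    exact ((stronglyMeasurable_condExp (m := MeasurableSpace.comap p mY)).comp_measurable
      h1).aestronglyMeasurable

theorem Hf_inv {p : X → Y} (hp : Measurable p) {T : X → X} {R R' : Y → Y}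
    (hT : Measurable T) (hR : Measurable R) (hR' : Measurable R')
    (hRR : ∀ y, R' (R y) = y)
    (hmap : Measure.map T μ = μ) (hfac : ∀ x, p (T x) = R (p x))
    {f : X → ι} (hf : LM f) :
    Hf (MeasurableSpace.comap p mY) μ (fun x => f (T x)) = Hf (MeasurableSpace.comap p mY) μ f := by
  unfold Hf
  refine Finset.sum_congr rfl fun i _ => ?_
  have h1 := condExp_inv hp hT hR hR' hRR hmap hfac (hf i)
  have e : (fun x => f (T x)) ⁻¹' {i} = T ⁻¹' (f ⁻¹' {i}) := rfl
  rw [e]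
  have h2 := setInt_inv (ψ := fun x => Real.negMulLog
    ((μ[(f ⁻¹' {i}).indicator (fun _ => (1 : ℝ)) | MeasurableSpace.comap p mY]) x)) hT hmap
    (Real.continuous_negMulLog.comp_aestronglyMeasurable
      integrable_condExp.aestronglyMeasurable) MeasurableSet.univ
  rw [Set.preimage_univ, setIntegral_univ, setIntegral_univ] at h2
  rw [← h2]
  refine integral_congr_ae ?_
  filter_upwards [h1] with x hx
  rw [← hx]

end Inv
end Ent
end Asc6
namespace Asc6
section Dynamics
open ProbabilityTheory

section Cls
variable {X : Type*}

def cls {α : Finset (Set X)} (hα : IsCover α) (x : X) : {A // A ∈ α} :=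
  ⟨(Set.mem_sUnion.1 (hα.symm ▸ Set.mem_univ x : x ∈ ⋃₀ (α : Set (Set X)))).choose,
    (Set.mem_sUnion.1 (hα.symm ▸ Set.mem_univ x : x ∈ ⋃₀ (α : Set (Set X)))).choose_spec.1⟩

theorem cls_mem {α : Finset (Set X)} (hα : IsCover α) (x : X) : x ∈ (cls hα x).1 :=
  (Set.mem_sUnion.1 (hα.symm ▸ Set.mem_univ x : x ∈ ⋃₀ (α : Set (Set X)))).choose_spec.2

variable [MeasurableSpace X]

theorem cls_eq_iff {α : Finset (Set X)} (hα : IsMPartition α) (x : X) (A : {A // A ∈ α}) :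
    cls hα.1 x = A ↔ x ∈ A.1 := by
  constructor
  · rintro rfl; exact cls_mem hα.1 x
  · intro h
    by_contra hne
    have := hα.2.2 _ (cls hα.1 x).2 _ A.2 (fun h => hne (Subtype.ext h))
    exact Set.disjoint_left.1 this (cls_mem hα.1 x) h

theorem cls_preimage {α : Finset (Set X)} (hα : IsMPartition α) (A : {A // A ∈ α}) :
    cls hα.1 ⁻¹' {A} = A.1 := by
  ext x; exact cls_eq_iff hα x A

theorem cls_LM {α : Finset (Set X)} (hα : IsMPartition α) : LM (cls hα.1) := by
  intro A; rw [cls_preimage hα]; exact hα.2.1 _ A.2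

theorem cls_eq_cls {α : Finset (Set X)} (hα : IsMPartition α) {x y : X} {A : Set X} (hA : A ∈ α)
    (hx : x ∈ A) : cls hα.1 x = cls hα.1 y ↔ y ∈ A := by
  have := (cls_eq_iff hα x ⟨A, hA⟩).2 hx
  rw [this, eq_comm, cls_eq_iff hα y]

theorem condEntPart_eq {Y : Type*} [mY : MeasurableSpace Y] (μ : Measure X) (p : X → Y)
    {α : Finset (Set X)} (hα : IsMPartition α) :
    condEntPart μ p α = Hf (MeasurableSpace.comap p mY) μ (cls hα.1) := by
  unfold condEntPart Hf
  simp only [cls_preimage hα]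
  exact (Finset.sum_coe_sort α (fun A => ∫ x, Real.negMulLog
    ((μ[A.indicator (fun _ => (1 : ℝ)) | MeasurableSpace.comap p mY]) x) ∂μ)).symm

open scoped Classical in
def partOf {ι : Type*} [Fintype ι] (f : X → ι) : Finset (Set X) :=
  Finset.univ.image fun i => f ⁻¹' {i}

theorem mem_partOf {ι : Type*} [Fintype ι] (f : X → ι) (A : Set X) :
    A ∈ partOf f ↔ ∃ i, f ⁻¹' {i} = A := by
  simp [partOf]

theorem partOf_part {ι : Type*} [Fintype ι] {f : X → ι} (hf : LM f) : IsMPartition (partOf f) := by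
  refine ⟨?_, ?_, ?_⟩
  · refine Set.eq_univ_of_forall fun x => Set.mem_sUnion.2 ⟨f ⁻¹' {f x}, ?_, rfl⟩
    exact (mem_partOf f _).2 ⟨_, rfl⟩
  · intro A hA
    obtain ⟨i, rfl⟩ := (mem_partOf f _).1 hA
    exact hf i
  · intro A hA B hB hAB
    obtain ⟨i, rfl⟩ := (mem_partOf f _).1 hA
    obtain ⟨j, rfl⟩ := (mem_partOf f _).1 hB
    refine Set.disjoint_left.2 fun x hx hy => hAB ?_
    have h1 : f x = i := hx
    have h2 : f x = j := hy
    rw [← h1, ← h2]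

theorem cls_partOf {ι : Type*} [Fintype ι] {f : X → ι} (hf : LM f) (x y : X) :
    cls (partOf_part hf).1 x = cls (partOf_part hf).1 y ↔ f x = f y := by
  rw [cls_eq_cls (partOf_part hf) ((mem_partOf f (f ⁻¹' {f x})).2 ⟨_, rfl⟩) (x := x) rfl]
  exact eq_comm

end Cls

section Nm
variable {G X ι : Type*} [DecidableEq G]

/-- name of a point along `S` -/
def nm (act : G → X → X) (a : X → ι) (S : Finset G) (x : X) : S → ι := fun s => a (act s x)

theorem nm_eq_iff (act : G → X → X) (a : X → ι) (S : Finset G) (x y : X) :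
    nm act a S x = nm act a S y ↔ ∀ s ∈ S, a (act s x) = a (act s y) := by
  constructor
  · intro h s hs; exact congrFun h ⟨s, hs⟩
  · intro h; funext s; exact h s.1 s.2

variable [MeasurableSpace X]

theorem nm_LM {act : G → X → X} (hact : ∀ g, Measurable (act g)) {a : X → ι} (ha : LM a)
    (S : Finset G) : LM (nm act a S) := by
  intro t
  have : nm act a S ⁻¹' {t} = ⋂ s : S, act s ⁻¹' (a ⁻¹' {t s}) := by
    ext x
    simp only [Set.mem_preimage, Set.mem_singleton_iff, Set.mem_iInter]
    exact funext_iff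
  rw [this]
  exact MeasurableSet.iInter fun s => hact _ (ha _)

theorem mem_coverDyn (act : G → X → X) (α : Finset (Set X)) (S : Finset G) (A : Set X) :
    A ∈ coverDyn act α S ↔ ∃ f : (g : G) → g ∈ S → Set X, (∀ g h, f g h ∈ α) ∧
      (⋂ g, ⋂ (h : g ∈ S), act g ⁻¹' f g h) = A := by
  simp [coverDyn, Finset.mem_image, Finset.mem_pi]

theorem coverDyn_part {act : G → X → X} (hact : ∀ g, Measurable (act g)) {α : Finset (Set X)}
    (hα : IsMPartition α) (S : Finset G) : IsMPartition (coverDyn act α S) := by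
  refine ⟨?_, ?_, ?_⟩
  · refine Set.eq_univ_of_forall fun x => Set.mem_sUnion.2
      ⟨_, (mem_coverDyn act α S _).2 ⟨fun g _ => (cls hα.1 (act g x)).1,
        fun g _ => (cls hα.1 (act g x)).2, rfl⟩, ?_⟩
    exact Set.mem_iInter₂.2 fun g _ => cls_mem hα.1 (act g x)
  · intro A hA
    obtain ⟨f, hf, rfl⟩ := (mem_coverDyn act α S _).1 hA
    have : (⋂ g, ⋂ (h : g ∈ S), act g ⁻¹' f g h) = ⋂ s : S, act s ⁻¹' f s.1 s.2 := by
      ext x; simp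
    rw [this]
    exact MeasurableSet.iInter fun s => hact _ (hα.2.1 _ (hf _ _))
  · intro A hA B hB hAB
    obtain ⟨f, hf, rfl⟩ := (mem_coverDyn act α S _).1 hA
    obtain ⟨f', hf', rfl⟩ := (mem_coverDyn act α S _).1 hB
    refine Set.disjoint_left.2 fun x hx hy => hAB ?_
    have : f = f' := by
      funext g h
      by_contra hne
      exact Set.disjoint_left.1 (hα.2.2 _ (hf g h) _ (hf' g h) hne)
        (Set.mem_iInter₂.1 hx g h) (Set.mem_iInter₂.1 hy g h)
    rw [this]

theorem cls_coverDyn {act : G → X → X} (hact : ∀ g, Measurable (act g)) {α : Finset (Set X)}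
    (hα : IsMPartition α) (S : Finset G) (x y : X) :
    cls (coverDyn_part hact hα S).1 x = cls (coverDyn_part hact hα S).1 y ↔
      nm act (cls hα.1) S x = nm act (cls hα.1) S y := by
  rw [cls_eq_cls (coverDyn_part hact hα S) ((mem_coverDyn act α S _).2
    ⟨fun g _ => (cls hα.1 (act g x)).1, fun g _ => (cls hα.1 (act g x)).2, rfl⟩)
    (Set.mem_iInter₂.2 fun g _ => cls_mem hα.1 (act g x)), nm_eq_iff, Set.mem_iInter₂]
  refine forall₂_congr fun g _ => ?_
  rw [eq_comm, cls_eq_iff hα]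
  rfl

end Nm

/-- bundled hypotheses -/
structure Dyn {G X Y : Type*} [Group G] [MeasurableSpace X] [MeasurableSpace Y]
    (act : G → X → X) (p : X → Y) (μ : Measure X) : Prop where
  meas : ∀ g, Measurable (act g)
  mul : ∀ g h x, act (g * h) x = act g (act h x)
  one : ∀ x, act 1 x = x
  pm : Measurable p
  map : ∀ g, Measure.map (act g) μ = μ
  fac : ∀ g, ∃ R R' : Y → Y, Measurable R ∧ Measurable R' ∧ (∀ y, R' (R y) = y) ∧
    ∀ x, p (act g x) = R (p x)

section Main
variable {G X Y : Type*} [Group G] [DecidableEq G] [MeasurableSpace X] [StandardBorelSpace X]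
  [mY : MeasurableSpace Y] {act : G → X → X} {p : X → Y} {μ : Measure X} [IsProbabilityMeasure μ]
  {ι κ : Type*} [Fintype ι] [Fintype κ]

/-- entropy of names -/
def HS (act : G → X → X) (p : X → Y) (μ : Measure X) (a : X → ι) (S : Finset G) : ℝ :=
  Hf (MeasurableSpace.comap p mY) μ (nm act a S)

theorem condEntPart_coverDyn (D : Dyn act p μ) {α : Finset (Set X)} (hα : IsMPartition α)
    (S : Finset G) : condEntPart μ p (coverDyn act α S) = HS act p μ (cls hα.1) S := by
  rw [condEntPart_eq μ p (coverDyn_part D.meas hα S)]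
  exact Hf_congr D.pm.comap_le (cls_LM (coverDyn_part D.meas hα S)) (nm_LM D.meas (cls_LM hα) S)
    fun x y => (cls_coverDyn D.meas hα S x y).symm

theorem HS_mono (D : Dyn act p μ) {a : X → ι} (ha : LM a) (g : G) (S : Finset G) :
    HS act p μ a S ≤ HS act p μ a (insert g S) := by
  refine Hf_mono D.pm.comap_le (nm_LM D.meas ha _) (nm_LM D.meas ha _) fun x y h => ?_
  rw [nm_eq_iff] at h ⊢
  exact fun s hs => h s (Finset.mem_insert_of_mem hs)

theorem LM_act (D : Dyn act p μ) {a : X → ι} (ha : LM a) (g : G) : LM (fun x => a (act g x)) :=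
  fun i => D.meas g (ha i)

theorem HS_sub (D : Dyn act p μ) {a : X → ι} (ha : LM a) (g : G) (S T : Finset G) (hST : S ⊆ T) :
    HS act p μ a (insert g T) + HS act p μ a S ≤ HS act p μ a (insert g S) + HS act p μ a T := by
  have hS := nm_LM D.meas ha S
  have hT := nm_LM D.meas ha T
  have hg := LM_act D ha g
  have h1 := Hf_ssa (μ := μ) D.pm.comap_le hS hT hg
  have h2 : HS act p μ a (insert g T) ≤
      Hf (MeasurableSpace.comap p mY) μ (fun x => (nm act a S x, nm act a T x, a (act g x))) := by
    refine Hf_mono D.pm.comap_le (nm_LM D.meas ha _) (hS.prod (hT.prod hg)) fun x y h => ?_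
    simp only [Prod.mk.injEq] at h
    rw [nm_eq_iff, nm_eq_iff] at h
    rw [nm_eq_iff]
    intro s hs
    rcases Finset.mem_insert.1 hs with rfl | hs
    · exact h.2.2
    · exact h.2.1 s hs
  have h3 : Hf (MeasurableSpace.comap p mY) μ (fun x => (nm act a S x, nm act a T x)) ≤
      HS act p μ a T := by
    refine Hf_mono D.pm.comap_le (hS.prod hT) hT fun x y h => ?_
    refine Prod.ext ?_ h
    rw [nm_eq_iff] at h
    exact (nm_eq_iff _ _ _ _ _).2 fun s hs => h s (hST hs)
  have h4 : Hf (MeasurableSpace.comap p mY) μ (fun x => (nm act a S x, a (act g x))) ≤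
      HS act p μ a (insert g S) := by
    refine Hf_mono D.pm.comap_le (hS.prod hg) (nm_LM D.meas ha _) fun x y h => ?_
    rw [nm_eq_iff] at h
    exact Prod.ext ((nm_eq_iff _ _ _ _ _).2 fun s hs => h s (Finset.mem_insert_of_mem hs))
      (h g (Finset.mem_insert_self _ _))
  have h5 : HS act p μ a S = Hf (MeasurableSpace.comap p mY) μ (nm act a S) := rfl
  linarith

theorem HS_empty (D : Dyn act p μ) {a : X → ι} (ha : LM a) : HS act p μ a ∅ = 0 := by
  rw [← Hf_unit (μ := μ) D.pm.comap_le]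
  refine Hf_congr D.pm.comap_le (nm_LM D.meas ha _) LM_unit fun x y => ?_
  simp [nm_eq_iff]

theorem HS_inv (D : Dyn act p μ) {a : X → ι} (ha : LM a) (g : G) (S : Finset G) :
    HS act p μ a (S.image fun h => h * g) = HS act p μ a S := by
  obtain ⟨R, R', hR, hR', hRR, hfac⟩ := D.fac g
  have h1 := Hf_inv D.pm (D.meas g) hR hR' hRR (D.map g) hfac (nm_LM D.meas ha S)
  unfold HS
  rw [← h1]
  refine Hf_congr D.pm.comap_le (nm_LM D.meas ha _)
    (fun i => D.meas g (nm_LM D.meas ha S i)) fun x y => ?_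
  rw [nm_eq_iff, nm_eq_iff]
  simp only [Finset.forall_mem_image, D.mul]

theorem HS_le_card (D : Dyn act p μ) {a : X → ι} (ha : LM a) (S : Finset G) :
    HS act p μ a S ≤ S.card * Hf (MeasurableSpace.comap p mY) μ a := by
  induction S using Finset.induction_on with
  | empty => rw [HS_empty D ha]; simp
  | insert g S hg ih =>
    have h1 := HS_sub D ha g ∅ S (Finset.empty_subset _)
    have h2 : HS act p μ a (insert g ∅) = Hf (MeasurableSpace.comap p mY) μ a := by
      have := HS_inv D ha g (insert 1 ∅)
      have e : ((insert 1 ∅ : Finset G).image fun h => h * g) = insert g ∅ := by simp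
      rw [e] at this
      rw [this]
      refine Hf_congr D.pm.comap_le (nm_LM D.meas ha _) ha fun x y => ?_
      simp [nm_eq_iff, D.one]
    rw [HS_empty D ha, h2] at h1
    rw [Finset.card_insert_of_notMem hg]
    push_cast
    linarith

end Main

section Coeff
variable {G : Type*} {lam : Measure ℝ}

theorem lam_ae (h : IsCoeffMeasure lam) : ∀ᵐ x ∂lam, x ∈ Set.Icc (0 : ℝ) 1 := h.2.1

theorem coeff_nonneg (h : IsCoeffMeasure lam) (A S : Finset G) : 0 ≤ coeff lam A S := by
  refine integral_nonneg_of_ae ?_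
  filter_upwards [lam_ae h] with x hx
  exact mul_nonneg (pow_nonneg hx.1 _) (pow_nonneg (sub_nonneg.2 hx.2) _)

theorem coeff_int (h : IsCoeffMeasure lam) (k l : ℕ) :
    Integrable (fun x : ℝ => x ^ k * (1 - x) ^ l) lam := by
  have := h.1
  refine Integrable.of_bound (by fun_prop) 1 ?_
  filter_upwards [lam_ae h] with x hx
  have h0 : 0 ≤ 1 - x := sub_nonneg.2 hx.2
  have h1 : 1 - x ≤ 1 := by linarith [hx.1]
  rw [Real.norm_of_nonneg (mul_nonneg (pow_nonneg hx.1 _) (pow_nonneg h0 _))]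
  exact mul_le_one₀ (pow_le_one₀ hx.1 hx.2) (pow_nonneg h0 _) (pow_le_one₀ h0 h1)

variable [DecidableEq G]

theorem coeff_cons (h : IsCoeffMeasure lam) (a : G) (A S : Finset G) (ha : a ∉ A) (hS : S ⊆ A) :
    coeff lam A S = coeff lam (insert a A) S + coeff lam (insert a A) (insert a S) := by
  unfold coeff
  rw [← integral_add (coeff_int h _ _) (coeff_int h _ _), Finset.card_insert_of_notMem ha,
    Finset.card_insert_of_notMem fun h => ha (hS h)]
  have hc := Finset.card_le_card hS
  have e1 : A.card + 1 - S.card = (A.card - S.card) + 1 := by omega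
  have e2 : A.card + 1 - (S.card + 1) = A.card - S.card := by omega
  rw [e1, e2]
  congr 1
  funext x
  ring

theorem coeff_sum (h : IsCoeffMeasure lam) (A : Finset G) :
    ∑ S ∈ A.powerset, coeff lam A S = 1 := by
  have key : av (coeff lam) (fun _ => 1) A = 1 := by
    induction A using Finset.induction_on with
    | empty => have := h.1; simp [av, coeff]
    | insert a A ha ih => rw [av_insert (coeff_cons h) ha, ih]; simp [inc]
  simpa [av] using key

theorem av_inv [Group G] {H : Finset G → ℝ}
    (hH : ∀ (g : G) S, H (S.image fun h => h * g) = H S) (g : G) (A : Finset G) :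
    av (coeff lam) H (A.image fun h => h * g) = av (coeff lam) H A := by
  have hinj : Function.Injective fun h : G => h * g := mul_left_injective g
  symm
  unfold av
  refine Finset.sum_bij (fun S _ => S.image fun h => h * g) ?_ ?_ ?_ ?_
  · intro S hS
    exact Finset.mem_powerset.2 (Finset.image_subset_image (Finset.mem_powerset.1 hS))
  · intro S _ T _ hST
    exact Finset.image_injective hinj hST
  · intro T hT
    obtain ⟨S, hS, rfl⟩ := Finset.subset_image_iff.1 (Finset.mem_powerset.1 hT)
    exact ⟨S, Finset.mem_powerset.2 (by exact_mod_cast hS), by simp⟩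
  · intro S _
    rw [hH]
    unfold coeff
    rw [Finset.card_image_of_injective _ hinj, Finset.card_image_of_injective _ hinj]

end Coeff

section Fin
variable {G X Y : Type*} [Group G] [DecidableEq G] [MeasurableSpace X] [StandardBorelSpace X]
  [mY : MeasurableSpace Y] {act : G → X → X} {p : X → Y} {μ : Measure X} [IsProbabilityMeasure μ]
  {κ : Type*} [Fintype κ] {lam : Measure ℝ} {F : ℕ → Finset G}

theorem asc_tendsto (D : Dyn act p μ) (hlam : IsCoeffMeasure lam) (hF : IsFolner F)
    {α : Finset (Set X)} (hα : IsMPartition α) :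
    Tendsto (ascCondPartSeq μ p (coeff lam) act α F) atTop
      (nhds (AscCondPart μ p (coeff lam) act α F)) := by
  have ha := cls_LM hα
  have hcons := coeff_cons (G := G) hlam
  have hc0 := coeff_nonneg (G := G) hlam
  obtain ⟨L, hL⟩ := folner_limit F hF (av (coeff lam) (HS act p μ (cls hα.1)))
    (by simp [av, HS_empty D ha])
    (av_mono1 hc0 hcons (HS_mono D ha))
    (by
      intro a A B hAB haB
      rw [av_insert hcons haB, av_insert hcons fun h => haB (hAB h)]
      have := inc_anti (c := coeff lam) hc0 hcons (HS_sub D ha) hAB haB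
      linarith)
    (av_inv (HS_inv D ha))
  have e : ascCondPartSeq μ p (coeff lam) act α F =
      fun n => (1 / ((F n).card : ℝ)) * av (coeff lam) (HS act p μ (cls hα.1)) (F n) := by
    funext n
    simp only [ascCondPartSeq, av, condEntPart_coverDyn D hα]
  unfold AscCondPart limSeq
  rw [← e] at hL
  rw [hL.limUnder_eq]
  exact hL

theorem asc_nonneg (D : Dyn act p μ) (hlam : IsCoeffMeasure lam) (hF : IsFolner F)
    {α : Finset (Set X)} (hα : IsMPartition α) :
    0 ≤ AscCondPart μ p (coeff lam) act α F := by
  refine ge_of_tendsto (asc_tendsto D hlam hF hα) (Eventually.of_forall fun n => ?_)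
  refine mul_nonneg (by positivity) (Finset.sum_nonneg fun S _ =>
    mul_nonneg (coeff_nonneg hlam _ _) ?_)
  rw [condEntPart_coverDyn D hα]
  exact Hf_nonneg D.pm.comap_le (nm_LM D.meas (cls_LM hα) S)

theorem asc_join (D : Dyn act p μ) (hlam : IsCoeffMeasure lam) (hF : IsFolner F)
    {α : Finset (Set X)} (hα : IsMPartition α) {r : X → κ} (hr : LM r) :
    AscCondPart μ p (coeff lam) act (partOf fun x => (cls hα.1 x, r x)) F ≤
      AscCondPart μ p (coeff lam) act α F + Hf (MeasurableSpace.comap p mY) μ r := by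
  have ha := cls_LM hα
  have hγ := partOf_part (ha.prod hr)
  refine le_of_tendsto_of_tendsto' (asc_tendsto D hlam hF hγ)
    ((asc_tendsto D hlam hF hα).add_const _) fun n => ?_
  have hFp : (0 : ℝ) < (F n).card := by exact_mod_cast (hF.1 n).card_pos
  set h := Hf (MeasurableSpace.comap p mY) μ r with hh
  have h0 : 0 ≤ h := Hf_nonneg D.pm.comap_le hr
  have key : ∀ S ∈ (F n).powerset, coeff lam (F n) S *
      condEntPart μ p (coverDyn act (partOf fun x => (cls hα.1 x, r x)) S) ≤
      coeff lam (F n) S * condEntPart μ p (coverDyn act α S) +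
        coeff lam (F n) S * ((F n).card * h) := by
    intro S hS
    rw [← mul_add]
    refine mul_le_mul_of_nonneg_left ?_ (coeff_nonneg hlam _ _)
    rw [condEntPart_coverDyn D hγ, condEntPart_coverDyn D hα]
    have h1 : HS act p μ (cls hγ.1) S ≤ Hf (MeasurableSpace.comap p mY) μ
        (fun x => (nm act (cls hα.1) S x, nm act r S x)) := by
      refine Hf_mono D.pm.comap_le (nm_LM D.meas (cls_LM hγ) S)
        ((nm_LM D.meas ha S).prod (nm_LM D.meas hr S)) fun x y h => ?_
      simp only [Prod.mk.injEq] at h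
      rw [nm_eq_iff, nm_eq_iff] at h
      rw [nm_eq_iff]
      intro s hs
      rw [cls_partOf (ha.prod hr)]
      exact Prod.ext (h.1 s hs) (h.2 s hs)
    have h2 := Hf_pair (μ := μ) D.pm.comap_le (nm_LM D.meas ha S) (nm_LM D.meas hr S)
    have h3 := HS_le_card D hr S
    have h4 : (S.card : ℝ) * h ≤ (F n).card * h := by
      refine mul_le_mul_of_nonneg_right ?_ h0
      exact_mod_cast Finset.card_le_card (Finset.mem_powerset.1 hS)
    have h5 : HS act p μ (cls hα.1) S = Hf (MeasurableSpace.comap p mY) μ (nm act (cls hα.1) S) := rfl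
    have h6 : HS act p μ r S = Hf (MeasurableSpace.comap p mY) μ (nm act r S) := rfl
    linarith
  have hs := Finset.sum_le_sum key
  rw [Finset.sum_add_distrib, ← Finset.sum_mul, coeff_sum hlam, one_mul] at hs
  unfold ascCondPartSeq
  have := mul_le_mul_of_nonneg_left hs (show 0 ≤ 1 / ((F n).card : ℝ) by positivity)
  refine this.trans (le_of_eq ?_)
  field_simp

theorem exists_idx {d : ℕ} (V : Fin d → Set X) (hV : (⋃ i, V i) = Set.univ)
    (hm : ∀ i, MeasurableSet (V i)) : ∃ f : X → Fin d, LM f ∧ ∀ x, x ∈ V (f x) := by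
  have h1 : ∀ x, ∃ j, x ∈ V j ∧ ∀ k, k < j → x ∉ V k := by
    intro x
    have hx : ∃ j, x ∈ V j := Set.mem_iUnion.1 (hV.symm ▸ Set.mem_univ x)
    obtain ⟨j, hj, hmin⟩ := WellFounded.has_min (wellFounded_lt (α := Fin d)) {j | x ∈ V j} hx
    exact ⟨j, hj, fun k hk hxk => hmin k hxk hk⟩
  choose f hf1 hf2 using h1
  refine ⟨f, fun j => ?_, hf1⟩
  have : f ⁻¹' {j} = V j ∩ ⋂ k : {k // k < j}, (V k)ᶜ := by
    ext x
    simp only [Set.mem_preimage, Set.mem_singleton_iff, Set.mem_inter_iff, Set.mem_iInter,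
      Set.mem_compl_iff]
    constructor
    · rintro rfl; exact ⟨hf1 x, fun k => hf2 x k k.2⟩
    · rintro ⟨h1, h2⟩
      rcases lt_trichotomy (f x) j with h | h | h
      · exact absurd (hf1 x) (h2 ⟨_, h⟩)
      · exact h
      · exact absurd h1 (hf2 x j h)
  rw [this]
  exact (hm j).inter (MeasurableSet.iInter fun k => (hm _).compl)

theorem mem_ofFun {d : ℕ} (U : Fin d → Set X) (A : Set X) : A ∈ ofFun U ↔ ∃ i, U i = A := by
  simp [ofFun]

open scoped Classical in
theorem plus_le (D : Dyn act p μ) (hlam : IsCoeffMeasure lam) (hF : IsFolner F) {d : ℕ}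
    {η δ : ℝ} (hη : ∀ t, 0 ≤ t → t < δ → Real.negMulLog t ≤ η ∧ Real.negMulLog (1 - t) ≤ η)
    (U V : Fin d → Set X)
    (hU : (⋃ i, U i) = Set.univ) (hUm : ∀ i, MeasurableSet (U i))
    (hV : (⋃ i, V i) = Set.univ) (hVm : ∀ i, MeasurableSet (V i))
    (hUV : (∑ i, (μ (symmDiff (U i) (V i))).toReal) < δ) :
    AscCondPlus μ p (coeff lam) act (ofFun V) F ≤
      AscCondPlus μ p (coeff lam) act (ofFun U) F + (d + 1) * η := by
  obtain ⟨u, hu, huU⟩ := exists_idx U hU hUm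
  obtain ⟨v, hv, hvV⟩ := exists_idx V hV hVm
  let R : Set X := ⋃ i, U i \ V i
  have hRm : MeasurableSet R := MeasurableSet.iUnion fun i => (hUm i).diff (hVm i)
  have hRd : μ.real R < δ := by
    refine lt_of_le_of_lt ?_ hUV
    refine (measureReal_iUnion_fintype_le (μ := μ) fun i => U i \ V i).trans ?_
    exact Finset.sum_le_sum fun i _ => measureReal_mono (fun x hx => Or.inl hx)
  let r : X → Option (Fin d) := fun x => if x ∈ R then some (v x) else none
  have hrn : r ⁻¹' {none} = Rᶜ := by ext x; simp [r]
  have hrs : ∀ j, r ⁻¹' {some j} = R ∩ v ⁻¹' {j} := by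
    intro j; ext x; simp [r]
  have hr : LM r := by
    rintro (_ | j)
    · rw [hrn]; exact hRm.compl
    · rw [hrs]; exact hRm.inter (hv j)
  have hH : Hf (MeasurableSpace.comap p mY) μ r ≤ (d + 1) * η := by
    refine (Hf_jensen D.pm.comap_le hr).trans ?_
    rw [Fintype.sum_option, hrn, probReal_compl_eq_one_sub hRm]
    have h1 := (hη _ measureReal_nonneg hRd).2
    have h2 : ∑ j : Fin d, Real.negMulLog (μ.real (r ⁻¹' {some j})) ≤ ∑ _j : Fin d, η := by
      refine Finset.sum_le_sum fun j _ => ?_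
      rw [hrs]
      exact (hη _ measureReal_nonneg
        ((measureReal_mono Set.inter_subset_left).trans_lt hRd)).1
    simp only [Finset.sum_const, Finset.card_univ, Fintype.card_fin, nsmul_eq_mul] at h2
    linarith
  rw [← sub_le_iff_le_add]
  refine le_csInf ⟨_, partOf u, partOf_part hu, ?_, rfl⟩ ?_
  · intro A hA
    obtain ⟨i, rfl⟩ := (mem_partOf _ _).1 hA
    refine ⟨U i, (mem_ofFun U _).2 ⟨i, rfl⟩, ?_⟩
    rintro x rfl
    exact huU x
  · rintro _ ⟨α, hα, hαU, rfl⟩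
    rw [sub_le_iff_le_add]
    have h1 := asc_join D hlam hF hα hr
    refine le_trans (csInf_le ?_ ⟨_, partOf_part ((cls_LM hα).prod hr), ?_, rfl⟩)
      (h1.trans (by linarith))
    · refine ⟨0, ?_⟩
      rintro _ ⟨β, hβ, _, rfl⟩
      exact asc_nonneg D hlam hF hβ
    · intro B hB
      obtain ⟨⟨A, o⟩, rfl⟩ := (mem_partOf _ _).1 hB
      rcases o with _ | j
      · obtain ⟨C, hC, hAC⟩ := hαU A.1 A.2
        obtain ⟨i, rfl⟩ := (mem_ofFun U _).1 hC
        refine ⟨V i, (mem_ofFun V _).2 ⟨i, rfl⟩, ?_⟩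
        intro x hx
        simp only [Set.mem_preimage, Set.mem_singleton_iff, Prod.mk.injEq] at hx
        have hxU : x ∈ U i := hAC ((cls_eq_iff hα x A).1 hx.1)
        have hxR : x ∈ Rᶜ := hrn ▸ hx.2
        by_contra hxV
        exact hxR (Set.mem_iUnion.2 ⟨i, hxU, hxV⟩)
      · refine ⟨V j, (mem_ofFun V _).2 ⟨j, rfl⟩, ?_⟩
        intro x hx
        simp only [Set.mem_preimage, Set.mem_singleton_iff, Prod.mk.injEq] at hx
        have hxR : x ∈ R ∩ v ⁻¹' {j} := hrs j ▸ hx.2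
        have : v x = j := hxR.2
        exact this ▸ hvV x

end Fin
end Dynamics
end Asc6


theorem statement6 {G X Y : Type*} [Group G] [DecidableEq G] [Countable G] [Infinite G]
    [MetricSpace X] [CompactSpace X] [MeasurableSpace X] [BorelSpace X]
    [MetricSpace Y] [CompactSpace Y] [MeasurableSpace Y] [BorelSpace Y]
    (act : G → X → X) (hactc : ∀ g : G, Continuous (act g))
    (hact1 : ∀ x : X, act 1 x = x)
    (hactm : ∀ g h : G, ∀ x : X, act (g * h) x = act g (act h x))
    (actY : G → Y → Y) (hactYc : ∀ g : G, Continuous (actY g))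
    (hactY1 : ∀ y : Y, actY 1 y = y)
    (hactYm : ∀ g h : G, ∀ y : Y, actY (g * h) y = actY g (actY h y))
    (π : X → Y) (hπc : Continuous π) (hπs : Function.Surjective π)
    (hfac : ∀ (g : G) (x : X), π (act g x) = actY g (π x))
    (F : ℕ → Finset G) (hF : IsFolner F)
    (lam : Measure ℝ) (hlam : IsCoeffMeasure lam)
    (μ : Measure X) (hμ : IsProbabilityMeasure μ)
    (hinv : ∀ g : G, Measure.map (act g) μ = μ)
    (d : ℕ) (hd : 0 < d) :
    ∀ ε > (0 : ℝ), ∃ δ > (0 : ℝ), ∀ U V : Fin d → Set X,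
      (⋃ i, U i) = Set.univ → (∀ i, MeasurableSet (U i)) →
      (⋃ i, V i) = Set.univ → (∀ i, MeasurableSet (V i)) →
      (∑ i, (μ (symmDiff (U i) (V i))).toReal) < δ →
      |AscCondPlus μ π (coeff lam) act (ofFun V) F -
        AscCondPlus μ π (coeff lam) act (ofFun U) F| < ε := by
  intro ε hε
  have D : Asc6.Dyn act π μ :=
    { meas := fun g => (hactc g).measurable
      mul := hactm
      one := hact1
      pm := hπc.measurable
      map := hinv
      fac := fun g => ⟨actY g, actY g⁻¹, (hactYc g).measurable, (hactYc g⁻¹).measurable,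
        fun y => by rw [← hactYm, inv_mul_cancel, hactY1], hfac g⟩ }
  set η : ℝ := ε / (2 * (d + 1)) with hηd
  have hη0 : 0 < η := by positivity
  have hηε : (d + 1) * η < ε := by
    have : (d + 1) * η = ε / 2 := by rw [hηd]; field_simp
    linarith
  have c1 : Tendsto Real.negMulLog (nhds 0) (nhds 0) := by
    simpa using Real.continuous_negMulLog.tendsto 0
  have c2 : Tendsto (fun t : ℝ => Real.negMulLog (1 - t)) (nhds 0) (nhds 0) := by
    have : Continuous fun t : ℝ => Real.negMulLog (1 - t) :=
      Real.continuous_negMulLog.comp (continuous_const.sub continuous_id)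
    simpa using this.tendsto 0
  obtain ⟨δ, hδ, hball⟩ := Metric.eventually_nhds_iff.1
    ((c1.eventually (gt_mem_nhds hη0)).and (c2.eventually (gt_mem_nhds hη0)))
  have hη : ∀ t, 0 ≤ t → t < δ → Real.negMulLog t ≤ η ∧ Real.negMulLog (1 - t) ≤ η := by
    intro t h0 h1
    have := hball (y := t) (by rw [Real.dist_eq, sub_zero, abs_of_nonneg h0]; exact h1)
    exact ⟨this.1.le, this.2.le⟩
  refine ⟨δ, hδ, fun U V hU hUm hV hVm hUV => ?_⟩
  have h1 := Asc6.plus_le D hlam hF hη U V hU hUm hV hVm hUV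
  have h2 := Asc6.plus_le D hlam hF hη V U hV hVm hU hUm
    (by simpa only [symmDiff_comm] using hUV)
  rw [abs_lt]
  constructor <;> linarith
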